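/- arXiv:2001.00547 — 3 statements merged into one kernel-verified Lean document; each statement's English description precedes it below -/
import Mathlib

section
/- Uniqueness of the normalized numerators: let r ≥ 1 and d ≥ 0, and let (P_n) and (P'_n), both indexed by n ∈ ℕ^r with |n| = d, be families of polynomials in ℤ[t_1,…,t_r] such that ∑_{|n|=d} P_n(t)·(1−t_1)^{d−n_1}⋯(1−t_r)^{d−n_r} = ∑_{|n|=d} P'_n(t)·(1−t_1)^{d−n_1}⋯(1−t_r)^{d−n_r} in ℤ[t_1,…,t_r]. Then P_n(1,…,1) = P'_n(1,…,1) for every n with |n| = d. In particular, for a finitely generated ℕ^r-graded B-module M and fixed D, the values Q_n(1,…,1) are the same for all level-D decompositions of Hilb_M. -/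
/-- The length of an `A`-module, as the height of `⊤` in its lattice of submodules
(for modules of finite length this is the usual Jordan–Hölder length). -/
noncomputable def modLength (A : Type) [CommRing A] (M : Type) [AddCommGroup M] [Module A M] : ℕ :=
  (Order.height (⊤ : Submodule A M)).toNat

section

variable {r : ℕ} {A B : Type} [CommRing A] [CommRing B] [Algebra A B]
  (𝒜 : (Fin r → ℕ) → Submodule A B)
  {M : Type} [AddCommGroup M] [Module A M] [Module B M] [IsScalarTower A B M]
  (ℳ : (Fin r → ℕ) → Submodule A M)

/-- The multigraded Hilbert series of an `ℕ^r`-graded module with graded pieces `ℳ ν`. -/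
noncomputable def hilbSeries : MvPowerSeries (Fin r) ℤ :=
  fun ν => (modLength A ↥(ℳ ν) : ℤ)

/-- Evaluation of an integer multivariate polynomial at `t₁ = ⋯ = t_r = 1`. -/
noncomputable def evalOne {r : ℕ} (Q : MvPolynomial (Fin r) ℤ) : ℤ :=
  MvPolynomial.eval (fun _ => 1) Q

/-- A level-`D` decomposition of a power series `H`. -/
def IsLevelDecomposition {r : ℕ} (H : MvPowerSeries (Fin r) ℤ) (D : ℕ)
    (Q : (Fin r → ℕ) → MvPolynomial (Fin r) ℤ) : Prop :=
  (∀ nv : Fin r → ℕ, (∑ i, nv i) ≠ D → Q nv = 0) ∧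
  ((∏ i : Fin r, (1 - MvPowerSeries.X i)) ^ D) * H =
    ∑ nv ∈ Finset.filter (fun nv => ∑ i, nv i = D)
        (Fintype.piFinset fun _ : Fin r => Finset.range (D + 1)),
      (↑(Q nv) : MvPowerSeries (Fin r) ℤ) * ∏ i : Fin r, (1 - MvPowerSeries.X i) ^ (D - nv i)

open MvPolynomial in
/-- Substituting `1 - Xᵢ` for `Xᵢ` turns evaluation at `(1, …, 1)` into the constant coefficient. -/
theorem coeff_zero_aeval_one_sub_X {r : ℕ} (R : MvPolynomial (Fin r) ℤ) :
    coeff 0 (aeval (fun i : Fin r => (1 - X i : MvPolynomial (Fin r) ℤ)) R) = evalOne R := by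
  have h : (constantCoeff (R := ℤ) (σ := Fin r)).comp
      (aeval (fun i : Fin r => (1 - X i : MvPolynomial (Fin r) ℤ))).toRingHom =
      eval (fun _ => 1) := by
    ext i <;> simp
  exact RingHom.congr_fun h R

open MvPolynomial in
theorem evalOne_eq_zero_of_sum_mul_prod_eq_zero {r d : ℕ}
    (R : (Fin r → ℕ) → MvPolynomial (Fin r) ℤ)
    (h : ∑ nv ∈ Finset.filter (fun nv => ∑ i, nv i = d)
      (Fintype.piFinset fun _ : Fin r => Finset.range (d + 1)),
      R nv * ∏ i : Fin r, (1 - X i) ^ (d - nv i) = 0)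
    (m : Fin r → ℕ) (hm : ∑ i, m i = d) : evalOne (R m) = 0 := by
  have hle : ∀ i, m i ≤ d := fun i =>
    hm ▸ Finset.single_le_sum (f := m) (fun _ _ => Nat.zero_le _) (Finset.mem_univ i)
  have hmem : m ∈ Finset.filter (fun nv => ∑ i, nv i = d)
      (Fintype.piFinset fun _ : Fin r => Finset.range (d + 1)) := by
    simp [hm, Fintype.mem_piFinset, hle]
  let e : (Fin r → ℕ) → Fin r →₀ ℕ := fun n => Finsupp.equivFunOnFinite.symm fun i => d - n i
  have hprod : ∀ n : Fin r → ℕ,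
      ∏ i : Fin r, (X i : MvPolynomial (Fin r) ℤ) ^ (d - n i) = monomial (e n) 1 := by
    intro n
    rw [monomial_eq, Finsupp.prod_fintype _ _ (by simp)]
    simp [e]
  have h' := congrArg
    (fun p => coeff (e m) (aeval (fun i : Fin r => (1 - X i : MvPolynomial (Fin r) ℤ)) p)) h
  simp only [map_sum, map_mul, map_prod, map_pow, map_sub, map_one, aeval_X, sub_sub_cancel,
    map_zero, hprod, coeff_sum, coeff_mul_monomial', coeff_zero, mul_one] at h'
  rw [Finset.sum_eq_single_of_mem m hmem] at h'
  · rwa [if_pos le_rfl, tsub_self, coeff_zero_aeval_one_sub_X] at h'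
  · intro n hn hnm
    refine if_neg fun hle' => hnm ?_
    simp only [Finset.mem_filter, Fintype.mem_piFinset, Finset.mem_range] at hn
    have hmn : ∀ i, m i ≤ n i := fun i => by
      have h₁ : d - n i ≤ d - m i := hle' i
      have h₂ := hn.1 i
      have h₃ := hle i
      omega
    funext i
    exact ((Finset.sum_eq_sum_iff_of_le fun i _ => hmn i).1 (hm.trans hn.2.symm) i
      (Finset.mem_univ i)).symm

open MvPolynomial in
theorem evalOne_eq_of_sum_mul_prod_eq {r d : ℕ}
    (P P' : (Fin r → ℕ) → MvPolynomial (Fin r) ℤ)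
    (h : ∑ nv ∈ Finset.filter (fun nv => ∑ i, nv i = d)
        (Fintype.piFinset fun _ : Fin r => Finset.range (d + 1)),
        P nv * ∏ i : Fin r, (1 - X i) ^ (d - nv i) =
      ∑ nv ∈ Finset.filter (fun nv => ∑ i, nv i = d)
        (Fintype.piFinset fun _ : Fin r => Finset.range (d + 1)),
        P' nv * ∏ i : Fin r, (1 - X i) ^ (d - nv i))
    (m : Fin r → ℕ) (hm : ∑ i, m i = d) : evalOne (P m) = evalOne (P' m) := by
  have h₀ := evalOne_eq_zero_of_sum_mul_prod_eq_zero (d := d) (fun n => P n - P' n)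
    (by simp only [sub_mul, Finset.sum_sub_distrib, h, sub_self]) m hm
  simpa [evalOne, sub_eq_zero] using h₀

/-- **Uniqueness of the normalized numerators** (Lemma 2.3).
If two families of polynomials `(P_n)_{|n|=d}` and `(P'_n)_{|n|=d}` in `ℤ[t₁,…,t_r]` satisfy
`∑_{|n|=d} P_n (1-t₁)^{d-n₁}⋯(1-t_r)^{d-n_r} = ∑_{|n|=d} P'_n (1-t₁)^{d-n₁}⋯(1-t_r)^{d-n_r}`,
then `P_n(1,…,1) = P'_n(1,…,1)` for all `n` with `|n| = d`.  In particular, for a finitely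
generated `ℕ^r`-graded `B`-module `M` and a fixed level `D`, the values `Q_n(1,…,1)` are the
same for all level-`D` decompositions of `Hilb_M`. -/
theorem levelDecomposition_evalOne_unique
    (hr : 0 < r) [IsArtinianRing A] [IsLocalRing A]
    [GradedAlgebra 𝒜]
    (hstd : Algebra.adjoin A (⋃ i : Fin r, ((𝒜 (Pi.single i 1) : Submodule A B) : Set B)) = ⊤)
    [SetLike.GradedSMul 𝒜 ℳ] [DirectSum.Decomposition ℳ]
    [Module.Finite B M]
    (d : ℕ) (P P' : (Fin r → ℕ) → MvPolynomial (Fin r) ℤ)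
    (hP0 : ∀ nv : Fin r → ℕ, (∑ i, nv i) ≠ d → P nv = 0)
    (hP'0 : ∀ nv : Fin r → ℕ, (∑ i, nv i) ≠ d → P' nv = 0)
    (heq : ∑ nv ∈ Finset.filter (fun nv => ∑ i, nv i = d)
             (Fintype.piFinset fun _ : Fin r => Finset.range (d + 1)),
             (P nv) * ∏ i : Fin r, (1 - MvPolynomial.X i) ^ (d - nv i) =
           ∑ nv ∈ Finset.filter (fun nv => ∑ i, nv i = d)
             (Fintype.piFinset fun _ : Fin r => Finset.range (d + 1)),
             (P' nv) * ∏ i : Fin r, (1 - MvPolynomial.X i) ^ (d - nv i)) :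
    (∀ nv : Fin r → ℕ, (∑ i, nv i) = d → evalOne (P nv) = evalOne (P' nv)) ∧
    (∀ (D : ℕ) (Q Q' : (Fin r → ℕ) → MvPolynomial (Fin r) ℤ),
      IsLevelDecomposition (hilbSeries ℳ) D Q → IsLevelDecomposition (hilbSeries ℳ) D Q' →
      ∀ nv : Fin r → ℕ, evalOne (Q nv) = evalOne (Q' nv)) := by
  refine ⟨evalOne_eq_of_sum_mul_prod_eq P P' heq, fun D Q Q' hQ hQ' nv => ?_⟩
  by_cases hnv : ∑ i, nv i = D
  · refine evalOne_eq_of_sum_mul_prod_eq Q Q' ?_ nv hnv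
    have hcoe := hQ.2.symm.trans hQ'.2
    apply MvPolynomial.coe_injective (Fin r) ℤ
    rw [← MvPolynomial.coeToMvPowerSeries.ringHom_apply,
      ← MvPolynomial.coeToMvPowerSeries.ringHom_apply]
    simpa only [map_sum, map_mul, map_prod, map_pow, map_sub, map_one,
      MvPolynomial.coeToMvPowerSeries.ringHom_apply, MvPolynomial.coe_X] using hcoe
  · rw [hQ.1 nv hnv, hQ'.1 nv hnv]

end
end

section
/- Multigraded van der Waerden theorem (algebraic form): let k be a field and A = k[x_{1,0},…,x_{1,d_1}] ⊗_k ⋯ ⊗_k k[x_{r,0},…,x_{r,d_r}] the ℕ^r-graded polynomial ring with deg(x_{i,j}) = e_i, let J ⊆ A be a graded ideal and B = A/J, and assume B ≠ Γ_𝔑(B). Let P_B be the Hilbert polynomial of B and let n ∈ ℕ^r with |n| equal to the total degree of P_B. For 1 ≤ i ≤ r let h_{i,1},…,h_{i,n_i} ∈ [A]_{e_i} be forms whose concatenation h_{1,1},…,h_{r,n_r} is a filter-regular sequence on B. Then for all ν ≫ 0 in ℕ^r, n_1!⋯n_r! times the coefficient of X_1^{n_1}⋯X_r^{n_r} in P_B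 equals dim_k [B/(h_{1,1},…,h_{r,n_r})B]_ν; in particular this dimension is independent of ν for ν ≫ 0 (this number is the degree over k of the zero-dimensional intersection of the multiprojective scheme defined by B with the corresponding filter-regular hyperplanes). -/
section

open MvPolynomial

variable {B : Type} [CommRing B]

/-- The multigraded irrelevant ideal `𝔑 = ⊕_{ν > 0} [B]_ν` of an `ℕ^r`-graded ring with
graded pieces given by `k`-submodules `𝒜 ν`. -/
def irrelevantIdealOf {r : ℕ} {k : Type} [CommRing k] [Algebra k B]
    (𝒜 : (Fin r → ℕ) → Submodule k B) : Ideal B :=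
  Ideal.span {b : B | ∃ ν : Fin r → ℕ, (∀ i, 0 < ν i) ∧ b ∈ 𝒜 ν}

/-- An element `z` of `B` is filter-regular on the `B`-module `M` if `z ∉ 𝔭` for every
associated prime `𝔭` of `M` with `𝔭 ⊉ 𝔑`. -/
def IsFilterRegular (𝔑 : Ideal B) (M : Type) [AddCommGroup M]
    [Module B M] (z : B) : Prop :=
  ∀ 𝔭 ∈ associatedPrimes B M, ¬ 𝔑 ≤ 𝔭 → z ∉ 𝔭

/-- The submodule `(z₁,…,z_m)M` of `M` generated by the elements of a list acting on `M`. -/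
def listSMulSub (L : List B) (M : Type) [AddCommGroup M] [Module B M] : Submodule B M :=
  Ideal.span {b : B | b ∈ L} • (⊤ : Submodule B M)

/-- A list `z₁,…,z_m` of elements of `B` is a filter-regular sequence on `M` if each `z_j`
is filter-regular on `M/(z₁,…,z_{j-1})M`. -/
def IsFilterRegularSeq (𝔑 : Ideal B) (M : Type) [AddCommGroup M]
    [Module B M] (L : List B) : Prop :=
  ∀ (j : ℕ) (hj : j < L.length),
    IsFilterRegular 𝔑 (M ⧸ listSMulSub (L.take j) M) (L.get ⟨j, hj⟩)

/-- `Γ_𝔑(M)`, the submodule of elements of `M` annihilated by some power of the ideal `𝔑`. -/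
def gammaTorsion (𝔑 : Ideal B) (M : Type) [AddCommGroup M]
    [Module B M] : Submodule B M :=
  ⨆ m : ℕ, Submodule.torsionBySet B M ((𝔑 ^ m : Ideal B) : Set B)

end

section BackwardDifference

open MvPolynomial

variable {σ S : Type*} [DecidableEq σ] [CommRing S]

/-- The backward difference operator `P ↦ P(X) - P(X - eᵢ)`. -/
noncomputable def backwardDiff (i : σ) : MvPolynomial σ S →ₗ[S] MvPolynomial σ S :=
  LinearMap.id - (aeval fun j => X j - C (if j = i then 1 else 0)).toLinearMap

lemma backwardDiff_apply (i : σ) (p : MvPolynomial σ S) :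
    backwardDiff i p = p - aeval (fun j => X j - C (if j = i then 1 else 0)) p := rfl

lemma eval_backwardDiff (i : σ) (p : MvPolynomial σ S) (x : σ → S) :
    eval x (backwardDiff i p) = eval x p - eval (fun j => x j - if j = i then 1 else 0) p := by
  rw [backwardDiff_apply, map_sub]
  congr 1
  induction p using MvPolynomial.induction_on with
  | C a => simp
  | add p q hp hq => simp only [map_add, hp, hq]
  | mul_X p j hp => simp only [map_mul, hp, aeval_X, eval_X, map_sub, eval_C]

lemma backwardDiff_mul_X (i j : σ) (p : MvPolynomial σ S) :
    backwardDiff i (p * X j) =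
      backwardDiff i p * X j + C (if j = i then 1 else 0) * (p - backwardDiff i p) := by
  simp only [backwardDiff_apply, map_mul, aeval_X]
  ring

lemma coeff_backwardDiff_monomial [IsDomain S] (i : σ) (a : σ →₀ ℕ) (c : S) (m : σ →₀ ℕ)
    (hm : (monomial a c).totalDegree ≤ m.degree + 1) :
    coeff m (backwardDiff i (monomial a c)) = coeff m (pderiv i (monomial a c)) := by
  revert m
  refine MvPolynomial.induction_on_monomial (motive := fun p => ∀ m : σ →₀ ℕ,
    p.totalDegree ≤ m.degree + 1 → coeff m (backwardDiff i p) = coeff m (pderiv i p)) ?_ ?_ a c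
  · intro b m _
    simp [backwardDiff_apply]
  · intro p j ih m hm
    rcases eq_or_ne p 0 with rfl | hp
    · simp
    rw [totalDegree_mul_of_isDomain hp (X_ne_zero j), totalDegree_X] at hm
    have h0 : coeff m (backwardDiff i p) = 0 := by
      rw [ih m (by omega), coeff_pderiv, coeff_eq_zero_of_totalDegree_lt, zero_mul]
      rw [← Finsupp.degree_apply, map_add, Finsupp.degree_single]
      omega
    rw [backwardDiff_mul_X, pderiv_mul, pderiv_X, coeff_add, coeff_add, coeff_C_mul, coeff_sub, h0,
      sub_zero]
    congr 1
    · rw [coeff_mul_X', coeff_mul_X']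
      split_ifs with hj
      · apply ih
        have : m = (m - Finsupp.single j 1) + Finsupp.single j 1 := by
          rw [tsub_add_cancel_of_le]
          rw [Finsupp.single_le_iff]
          exact Nat.one_le_iff_ne_zero.mpr (Finsupp.mem_support_iff.mp hj)
        rw [this, map_add, Finsupp.degree_single] at hm
        omega
      · rfl
    · rcases eq_or_ne j i with rfl | hji
      · simp
      · simp [hji]

lemma coeff_backwardDiff [IsDomain S] (i : σ) (p : MvPolynomial σ S) (m : σ →₀ ℕ)
    (hm : p.totalDegree ≤ m.degree + 1) :
    coeff m (backwardDiff i p) = coeff (m + Finsupp.single i 1) p * (m i + 1) := by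
  rw [← coeff_pderiv]
  conv_lhs => rw [p.as_sum]
  conv_rhs => rw [p.as_sum]
  simp only [map_sum, coeff_sum]
  refine Finset.sum_congr rfl fun a ha => coeff_backwardDiff_monomial i a _ m ?_
  refine (totalDegree_monomial_le _ _).trans (le_trans ?_ hm)
  exact le_totalDegree ha

lemma totalDegree_backwardDiff_le [IsDomain S] (i : σ) (p : MvPolynomial σ S) {d : ℕ}
    (hd : p.totalDegree ≤ d + 1) : (backwardDiff i p).totalDegree ≤ d := by
  refine Finset.sup_le fun m hm => ?_
  by_contra! hlt
  have hlt' : d < m.degree := hlt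
  rw [mem_support_iff, coeff_backwardDiff i p m (by omega), coeff_eq_zero_of_totalDegree_lt,
    zero_mul] at hm
  · exact hm rfl
  · rw [← Finsupp.degree_apply, map_add, Finsupp.degree_single]
    omega

end BackwardDifference

section Colon

variable {R : Type} [CommRing R]

lemma exists_pow_smul_eq_zero_of_isFilterRegular [IsNoetherianRing R] (𝔑 : Ideal R) (M : Type) [AddCommGroup M]
    [Module R M] [Module.Finite R M] {z : R} (hz : IsFilterRegular 𝔑 M z) :
    ∃ m : ℕ, ∀ a ∈ 𝔑 ^ m, ∀ x : M, z • x = 0 → a • x = 0 := by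
  let K := Submodule.torsionBy R M z
  have hle : 𝔑 ≤ (Module.annihilator R K).radical := by
    rw [← Ideal.sInf_minimalPrimes]
    refine le_sInf fun p hp => ?_
    have hpK := Module.associatedPrimes.minimalPrimes_annihilator_subset_associatedPrimes R K hp
    have hpM := associatedPrimes.subset_of_injective K.injective_subtype hpK
    by_contra hN
    refine hz p hpM hN (hp.1.2 (Module.mem_annihilator.mpr fun x => Subtype.ext ?_))
    exact (Submodule.mem_torsionBy_iff _ _).mp x.2
  obtain ⟨m, hm⟩ := Ideal.exists_pow_le_of_le_radical_of_fg hle 𝔑.fg_of_isNoetherianRing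
  refine ⟨m, fun a ha x hx => ?_⟩
  have := Module.mem_annihilator.mp (hm ha) ⟨x, (Submodule.mem_torsionBy_iff _ _).mpr hx⟩
  exact congrArg Subtype.val this

lemma exists_pow_mem_of_mul_mem [IsNoetherianRing R] (𝔑 I : Ideal R) {z : R} (hz : IsFilterRegular 𝔑 (R ⧸ I) z) :
    ∃ N : ℕ, ∀ f ∈ 𝔑 ^ N, z * f ∈ I → f ∈ I := by
  obtain ⟨m, hm⟩ := exists_pow_smul_eq_zero_of_isFilterRegular 𝔑 (R ⧸ I) hz
  let Q : Ideal R := Submodule.comap (LinearMap.mulLeft R z) I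
  obtain ⟨c, hc⟩ := Ideal.exists_pow_inf_eq_pow_smul 𝔑 Q
  refine ⟨m + c, fun f hf hzf => ?_⟩
  have hle : 𝔑 ^ m * Q ≤ I := by
    refine Ideal.mul_le.mpr fun a ha q hq => ?_
    have := hm a ha (Ideal.Quotient.mk I q) (Ideal.Quotient.eq_zero_iff_mem.mpr hq)
    exact Ideal.Quotient.eq_zero_iff_mem.mp this
  have hmem : f ∈ 𝔑 ^ (m + c) • (⊤ : Ideal R) ⊓ Q := ⟨by simpa using hf, hzf⟩
  rw [hc (m + c) (by omega), Nat.add_sub_cancel] at hmem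
  exact hle (Submodule.smul_mono le_rfl inf_le_right hmem)

lemma mk_mem_listSMulSub_iff (J : Ideal R) (L : List R) (f : R) :
    (Submodule.Quotient.mk f : R ⧸ J) ∈ listSMulSub L (R ⧸ J) ↔ f ∈ J ⊔ Ideal.ofList L := by
  have : listSMulSub L (R ⧸ J) = Submodule.map J.mkQ (Ideal.ofList L) := by
    rw [listSMulSub, ← Submodule.range_mkQ J, LinearMap.range_eq_map, ← Submodule.map_smul'']
    simp
  rw [this, ← Submodule.comap_map_mkQ]
  rfl

lemma isFilterRegular_quotient_listSMulSub_iff (𝔑 J : Ideal R) (L : List R) (z : R) :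
    IsFilterRegular 𝔑 ((R ⧸ J) ⧸ listSMulSub L (R ⧸ J)) z ↔
      IsFilterRegular 𝔑 (R ⧸ (J ⊔ Ideal.ofList L)) z := by
  let φ : R →ₗ[R] (R ⧸ J) ⧸ listSMulSub L (R ⧸ J) := (listSMulSub L (R ⧸ J)).mkQ ∘ₗ J.mkQ
  have hker : J ⊔ Ideal.ofList L = LinearMap.ker φ := by
    ext f
    rw [← mk_mem_listSMulSub_iff, LinearMap.mem_ker]
    exact (Submodule.Quotient.mk_eq_zero _).symm
  have hsurj : Function.Surjective φ :=
    (Submodule.mkQ_surjective _).comp (Submodule.mkQ_surjective _)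
  have e := Submodule.quotEquivOfEq _ _ hker ≪≫ₗ φ.quotKerEquivOfSurjective hsurj
  rw [IsFilterRegular, IsFilterRegular, LinearEquiv.AssociatedPrimes.eq e]

end Colon

section Multigraded

open MvPolynomial

variable {r : ℕ} {k : Type} [Field k] {σ : Type} (c : σ → Fin r)

/-- The weight giving each variable `s` the multidegree `e_{c s}`. -/
abbrev multiWeight (s : σ) : Fin r → ℕ := Pi.single (c s) 1

/-- The irrelevant ideal of the multigraded polynomial ring. -/
noncomputable abbrev irrelevantIdeal (k : Type) [Field k] : Ideal (MvPolynomial σ k) :=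
  irrelevantIdealOf fun ν => weightedHomogeneousSubmodule k (multiWeight c) ν

/-- The Hilbert function of the quotient by `I`. -/
noncomputable def hilbertFn (I : Ideal (MvPolynomial σ k)) (ν : Fin r → ℕ) : ℕ :=
  Module.finrank k ((weightedHomogeneousSubmodule k (multiWeight c) ν).map
    (Ideal.Quotient.mkₐ k I).toLinearMap)

lemma le_weight_multiWeight (a : σ →₀ ℕ) (s : σ) :
    a s ≤ Finsupp.weight (multiWeight c) a (c s) := by
  have h := Finsupp.le_weight (fun t => multiWeight c t (c s)) (s := s) (by simp) a
  refine h.trans_eq ?_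
  simp [Finsupp.weight_apply, Finsupp.sum]

lemma finite_weightedHomogeneousSubmodule [Finite σ] (ν : Fin r → ℕ) :
    Module.Finite k (weightedHomogeneousSubmodule k (multiWeight c) ν) := by
  classical
  rw [weightedHomogeneousSubmodule_eq_finsupp_supported]
  have hfin : {a : σ →₀ ℕ | Finsupp.weight (multiWeight c) a = ν}.Finite := by
    refine (Set.finite_Iic (Finsupp.equivFunOnFinite.symm fun s => ν (c s))).subset ?_
    rintro a rfl s
    exact le_weight_multiWeight c a s
  have := hfin.to_subtype
  exact Module.Finite.of_basis (basisRestrictSupport k _)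

lemma monomial_mem_irrelevantIdeal_pow (N : ℕ) (a : σ →₀ ℕ) (b : k)
    (ha : ∀ i, N ≤ Finsupp.weight (multiWeight c) a i) :
    monomial a b ∈ irrelevantIdeal c k ^ N := by
  classical
  induction N generalizing a b with
  | zero => simp
  | succ N ih =>
    have hex : ∀ i, ∃ s, c s = i ∧ a s ≠ 0 := by
      intro i
      by_contra! hs
      have h := ha i
      rw [Finsupp.weight_apply, Finsupp.sum, Finset.sum_apply, Finset.sum_eq_zero] at h
      · omega
      · intro s _
        by_cases hsi : c s = i
        · simp [hs s hsi]
        · simp [Pi.single_eq_of_ne (Ne.symm hsi)]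
    choose s hs hs0 using hex
    let m : σ →₀ ℕ := ∑ i, Finsupp.single (s i) 1
    have hw : Finsupp.weight (multiWeight c) m = 1 := by
      simp only [m, map_sum, Finsupp.weight_single, one_smul, multiWeight, hs]
      exact Finset.univ_sum_single (1 : Fin r → ℕ)
    have hle : m ≤ a := by
      intro t
      simp only [m, Finsupp.finsetSum_apply, Finsupp.single_apply, Finset.sum_boole]
      by_cases ht : a t = 0
      · rw [ht, Nat.cast_id, Nat.le_zero, Finset.card_eq_zero, Finset.filter_eq_empty_iff]
        rintro i - rfl
        exact hs0 i ht
      · refine le_trans (Finset.card_le_one.mpr ?_) (Nat.one_le_iff_ne_zero.mpr ht)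
        simp only [Finset.mem_filter, Finset.mem_univ, true_and]
        rintro i hi j hj
        rw [← hs i, ← hs j, hi, hj]
    have hsplit : monomial a b = monomial (a - m) b * monomial m 1 := by
      rw [monomial_mul, tsub_add_cancel_of_le hle, mul_one]
    rw [hsplit, pow_succ]
    refine Ideal.mul_mem_mul (ih _ _ fun i => ?_) (Ideal.subset_span ⟨1, fun _ => one_pos, ?_⟩)
    · have h := ha i
      rw [← tsub_add_cancel_of_le hle, map_add, hw] at h
      simpa using h
    · exact isWeightedHomogeneous_monomial _ _ _ hw

lemma mem_irrelevantIdeal_pow {N : ℕ} {ν : Fin r → ℕ} (hν : ∀ i, N ≤ ν i) {f : MvPolynomial σ k}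
    (hf : f ∈ weightedHomogeneousSubmodule k (multiWeight c) ν) :
    f ∈ irrelevantIdeal c k ^ N := by
  rw [f.as_sum]
  refine Ideal.sum_mem _ fun a ha => monomial_mem_irrelevantIdeal_pow c N a _ ?_
  rwa [hf (mem_support_iff.mp ha)]

/-- Closure under taking multigraded components. -/
def IsMultihomogeneous (I : Ideal (MvPolynomial σ k)) : Prop :=
  ∀ p ∈ I, ∀ ν : Fin r → ℕ, weightedHomogeneousComponent (multiWeight c) ν p ∈ I

open scoped Classical in
attribute [local instance] MvPolynomial.weightedGradedAlgebra in
lemma weightedHomogeneousComponent_mul_left {e : Fin r → ℕ} {z : MvPolynomial σ k}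
    (hz : z ∈ weightedHomogeneousSubmodule k (multiWeight c) e) (q : MvPolynomial σ k)
    (ν : Fin r → ℕ) :
    weightedHomogeneousComponent (multiWeight c) ν (z * q) =
      if e ≤ ν then z * weightedHomogeneousComponent (multiWeight c) (ν - e) q else 0 := by
  simp_rw [← weightedDecomposition.decompose'_apply]
  exact DirectSum.coe_decompose_mul_of_left_mem
    (weightedHomogeneousSubmodule k (multiWeight c)) ν hz

variable {c}

lemma IsMultihomogeneous.sup_span_singleton {I : Ideal (MvPolynomial σ k)}
    (hI : IsMultihomogeneous c I) {e : Fin r → ℕ} {z : MvPolynomial σ k}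
    (hz : z ∈ weightedHomogeneousSubmodule k (multiWeight c) e) :
    IsMultihomogeneous c (I ⊔ Ideal.span {z}) := by
  classical
  intro p hp ν
  obtain ⟨a, ha, b, hb, rfl⟩ := Submodule.mem_sup.mp hp
  obtain ⟨q, rfl⟩ := Ideal.mem_span_singleton.mp hb
  rw [map_add, weightedHomogeneousComponent_mul_left c hz]
  refine add_mem (Ideal.mem_sup_left (hI a ha ν)) (Ideal.mem_sup_right ?_)
  split_ifs
  · exact Ideal.mul_mem_right _ _ (Ideal.mem_span_singleton_self z)
  · exact zero_mem _

lemma finrank_map_add_finrank_inf_ker {V W : Type*} [AddCommGroup V] [Module k V]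
    [AddCommGroup W] [Module k W] (f : V →ₗ[k] W) (p : Submodule k V) [Module.Finite k p] :
    Module.finrank k (p.map f) + Module.finrank k ↥(p ⊓ LinearMap.ker f) =
      Module.finrank k p := by
  rw [← (f.domRestrict p).finrank_range_add_finrank_ker, LinearMap.range_domRestrict,
    LinearMap.ker_domRestrict, ← Submodule.finrank_map_subtype_eq p, Submodule.map_comap_subtype]

lemma finrank_map_eq_of_ker_eq {V W W' : Type*} [AddCommGroup V] [Module k V]
    [AddCommGroup W] [Module k W] [AddCommGroup W'] [Module k W'] {f : V →ₗ[k] W}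
    {g : V →ₗ[k] W'} (p : Submodule k V) [Module.Finite k p]
    (hfg : LinearMap.ker f = LinearMap.ker g) :
    Module.finrank k (p.map f) = Module.finrank k (p.map g) := by
  have hf := finrank_map_add_finrank_inf_ker f p
  have hg := finrank_map_add_finrank_inf_ker g p
  rw [hfg] at hf
  omega

lemma hilbertFn_sup_span_singleton [Finite σ] {I : Ideal (MvPolynomial σ k)}
    (hI : IsMultihomogeneous c I) {e ν : Fin r → ℕ} (hν : e ≤ ν) {z : MvPolynomial σ k}
    (hz : z ∈ weightedHomogeneousSubmodule k (multiWeight c) e)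
    (hreg : ∀ f ∈ weightedHomogeneousSubmodule k (multiWeight c) (ν - e), z * f ∈ I → f ∈ I) :
    hilbertFn c (I ⊔ Ideal.span {z}) ν + hilbertFn c I (ν - e) = hilbertFn c I ν := by
  classical
  have hfin := finite_weightedHomogeneousSubmodule (k := k) c ν
  have hfin' := finite_weightedHomogeneousSubmodule (k := k) c (ν - e)
  let V := weightedHomogeneousSubmodule k (multiWeight c) ν
  let V' := weightedHomogeneousSubmodule k (multiWeight c) (ν - e)
  let π (I' : Ideal (MvPolynomial σ k)) := (Ideal.Quotient.mkₐ k I').toLinearMap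
  have hπ (I' : Ideal (MvPolynomial σ k)) (f : MvPolynomial σ k) : π I' f = 0 ↔ f ∈ I' :=
    Ideal.Quotient.eq_zero_iff_mem
  let I' := I ⊔ Ideal.span {z}
  let g := π I ∘ₗ LinearMap.mulLeft k z
  have hfin'' : Module.Finite k ↥(V ⊓ LinearMap.ker (π I')) :=
    Submodule.finiteDimensional_of_le inf_le_left
  have hmap : (V ⊓ LinearMap.ker (π I')).map (π I) = V'.map g := by
    apply le_antisymm
    · rintro _ ⟨y, ⟨hyV, hyI⟩, rfl⟩
      obtain ⟨a, ha, b, hb, rfl⟩ := Submodule.mem_sup.mp ((hπ I' y).mp hyI)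
      obtain ⟨q, rfl⟩ := Ideal.mem_span_singleton.mp hb
      refine ⟨weightedHomogeneousComponent (multiWeight c) (ν - e) q,
        weightedHomogeneousComponent_mem _ _ _, ?_⟩
      have hy := IsWeightedHomogeneous.weightedHomogeneousComponent_same hyV
      rw [map_add, weightedHomogeneousComponent_mul_left c hz, if_pos hν] at hy
      rw [← hy, map_add, (hπ I _).mpr (hI a ha ν), zero_add]
      rfl
    · rintro _ ⟨x, hx, rfl⟩
      refine ⟨z * x, ⟨?_, (hπ I' _).mpr ?_⟩, rfl⟩
      · have := IsWeightedHomogeneous.mul (w := multiWeight c) hz hx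
        rwa [add_tsub_cancel_of_le hν] at this
      · exact Ideal.mem_sup_right (Ideal.mul_mem_right _ _ (Ideal.mem_span_singleton_self z))
  have hker : V' ⊓ LinearMap.ker g = V' ⊓ LinearMap.ker (π I) := by
    ext f
    refine and_congr_right fun hf => ?_
    change π I (z * f) = 0 ↔ π I f = 0
    rw [hπ, hπ]
    exact ⟨hreg f hf, fun h => Ideal.mul_mem_left _ _ h⟩
  have hinf : V ⊓ LinearMap.ker (π I') ⊓ LinearMap.ker (π I) = V ⊓ LinearMap.ker (π I) := by
    have hle : LinearMap.ker (π I) ≤ LinearMap.ker (π I') := fun f hf =>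
      (hπ I' f).mpr (Ideal.mem_sup_left ((hπ I f).mp hf))
    rw [inf_assoc, inf_eq_right.mpr hle]
  have h1 := finrank_map_add_finrank_inf_ker (π I') V
  have h2 := finrank_map_add_finrank_inf_ker (π I) V
  have h3 := finrank_map_add_finrank_inf_ker (π I) (V ⊓ LinearMap.ker (π I'))
  have h4 := finrank_map_add_finrank_inf_ker g V'
  have h5 := finrank_map_add_finrank_inf_ker (π I) V'
  rw [hmap, hinf] at h3
  rw [hker] at h4
  change Module.finrank k (V.map (π I')) + Module.finrank k (V'.map (π I)) =
    Module.finrank k (V.map (π I))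
  omega

/-- `P` agrees with the Hilbert function of the quotient by `I` in all large multidegrees. -/
def IsHilbertPolynomial (c : σ → Fin r) (I : Ideal (MvPolynomial σ k))
    (P : MvPolynomial (Fin r) ℚ) : Prop :=
  ∃ ν₀ : Fin r → ℕ, ∀ ν : Fin r → ℕ, (∀ i, ν₀ i ≤ ν i) →
    eval (fun i => (ν i : ℚ)) P = (hilbertFn c I ν : ℚ)

lemma IsHilbertPolynomial.sup_span_singleton [Finite σ] {I : Ideal (MvPolynomial σ k)}
    (hI : IsMultihomogeneous c I) {P : MvPolynomial (Fin r) ℚ} (hP : IsHilbertPolynomial c I P)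
    {i : Fin r} {z : MvPolynomial σ k}
    (hz : z ∈ weightedHomogeneousSubmodule k (multiWeight c) (Pi.single i 1))
    (hreg : ∃ N : ℕ, ∀ f ∈ irrelevantIdeal c k ^ N, z * f ∈ I → f ∈ I) :
    IsHilbertPolynomial c (I ⊔ Ideal.span {z}) (backwardDiff i P) := by
  obtain ⟨ν₀, hν₀⟩ := hP
  obtain ⟨N, hN⟩ := hreg
  refine ⟨fun j => ν₀ j + N + 1, fun ν hν => ?_⟩
  have hsub (j : Fin r) : ν j ≤ (ν - Pi.single i 1 : Fin r → ℕ) j + 1 := by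
    rw [Pi.sub_apply, Pi.single_apply]
    split_ifs <;> omega
  have hle : (Pi.single i 1 : Fin r → ℕ) ≤ ν := by
    intro j
    have : ν₀ j + N + 1 ≤ ν j := hν j
    change (Pi.single i 1 : Fin r → ℕ) j ≤ (ν j : ℕ)
    rw [Pi.single_apply]
    split_ifs <;> omega
  have hH := hilbertFn_sup_span_singleton hI hle hz fun f hf =>
    hN f (mem_irrelevantIdeal_pow c (fun j => by have : ν₀ j + N + 1 ≤ ν j := hν j; have := hsub j; omega) hf)
  have h1 := hν₀ ν fun j => by have : ν₀ j + N + 1 ≤ ν j := hν j; omega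
  have h2 := hν₀ (ν - Pi.single i 1) fun j => by have : ν₀ j + N + 1 ≤ ν j := hν j; have := hsub j; omega
  have hcast : (fun j => (ν j : ℚ) - if j = i then 1 else 0) =
      fun j => (((ν - Pi.single i 1 : Fin r → ℕ) j : ℕ) : ℚ) := by
    funext j
    have := hle j
    rw [Pi.sub_apply, Nat.cast_sub this, Pi.single_apply]
    split_ifs <;> simp
  rw [eval_backwardDiff, hcast, h1, h2, ← hH]
  push_cast
  ring

lemma hilbertFn_sup_ofList_eventually_eq [Finite σ] (l : List (Fin r × MvPolynomial σ k))
    {I : Ideal (MvPolynomial σ k)} (hI : IsMultihomogeneous c I)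
    (hdeg : ∀ x ∈ l, x.2 ∈ weightedHomogeneousSubmodule k (multiWeight c) (Pi.single x.1 1))
    (hreg : ∀ l₁ x l₂, l = l₁ ++ x :: l₂ → ∃ N : ℕ, ∀ f ∈ irrelevantIdeal c k ^ N,
      x.2 * f ∈ I ⊔ Ideal.ofList (l₁.map Prod.snd) → f ∈ I ⊔ Ideal.ofList (l₁.map Prod.snd))
    {P : MvPolynomial (Fin r) ℚ} (hP : IsHilbertPolynomial c I P) {n : Fin r →₀ ℕ}
    (hn : ∀ i, n i = (l.map Prod.fst).count i) (hPn : P.totalDegree ≤ n.degree) :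
    ∃ ν₀ : Fin r → ℕ, ∀ ν : Fin r → ℕ, (∀ i, ν₀ i ≤ ν i) →
      (∏ i, ((n i).factorial : ℚ)) * coeff n P =
        (hilbertFn c (I ⊔ Ideal.ofList (l.map Prod.snd)) ν : ℚ) := by
  induction l generalizing I P n with
  | nil =>
    obtain rfl : n = 0 := by ext i; simp [hn i]
    obtain ⟨ν₀, hν₀⟩ := hP
    refine ⟨ν₀, fun ν hν => ?_⟩
    have hC : P = C (coeff 0 P) := totalDegree_eq_zero_iff_eq_C.mp (by simpa using hPn)
    rw [List.map_nil, Ideal.ofList_nil, sup_bot_eq, ← hν₀ ν hν]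
    conv_rhs => rw [hC]
    simp
  | cons y l ih =>
    obtain ⟨i, z⟩ := y
    have hz := hdeg (i, z) (by simp)
    obtain ⟨n', rfl⟩ : ∃ n' : Fin r →₀ ℕ, n = n' + Finsupp.single i 1 := by
      refine ⟨n - Finsupp.single i 1, (tsub_add_cancel_of_le ?_).symm⟩
      rw [Finsupp.single_le_iff, hn i]
      simp
    rw [map_add, Finsupp.degree_single] at hPn
    have hassoc (l₁ : List (Fin r × MvPolynomial σ k)) :
        I ⊔ Ideal.ofList (((i, z) :: l₁).map Prod.snd) =
          (I ⊔ Ideal.span {z}) ⊔ Ideal.ofList (l₁.map Prod.snd) := by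
      rw [List.map_cons, Ideal.ofList_cons, sup_assoc]
    have hfac : (∏ j, (((n' + Finsupp.single i 1 : Fin r →₀ ℕ) j).factorial : ℚ)) =
        (∏ j, ((n' j).factorial : ℚ)) * (n' i + 1) := by
      rw [Fintype.prod_eq_mul_prod_compl i, Fintype.prod_eq_mul_prod_compl i (fun j => _)]
      rw [Finset.prod_congr rfl (g := fun j => ((n' j).factorial : ℚ))]
      · simp [Nat.factorial_succ]
        ring
      · intro j hj
        have : j ≠ i := by simpa using hj
        simp [Finsupp.single_eq_of_ne this]
    rw [hassoc, hfac]
    have hcoeff := coeff_backwardDiff i P n' hPn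
    have := ih (hI.sup_span_singleton hz) (fun x hx => hdeg x (by simp [hx]))
      (fun l₁ x l₂ hl => by
        have := hreg ((i, z) :: l₁) x l₂ (by rw [hl, List.cons_append])
        rwa [hassoc] at this)
      (hP.sup_span_singleton hI hz (by
        have := hreg [] (i, z) l rfl
        simpa using this))
      (n := n') (fun j => by
        have := hn j
        rw [List.map_cons, List.count_cons] at this
        rcases eq_or_ne i j with rfl | hij
        · simpa using this
        · simpa [hij, Finsupp.single_eq_of_ne hij.symm] using this)
      (totalDegree_backwardDiff_le i P hPn)
    rw [hcoeff] at this
    convert this using 5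
    ring

end Multigraded

/-- **Multigraded van der Waerden theorem, algebraic form** (Theorem 4.7).
Let `𝒫 = k[x_{i,j} : 1 ≤ i ≤ r, 0 ≤ j ≤ dᵢ]` be the `ℕ^r`-graded polynomial ring with
`deg x_{i,j} = eᵢ`, `J ⊆ 𝒫` a graded ideal, `B = 𝒫/J` with `B ≠ Γ_𝔑(B)`, `P_B` the Hilbert
polynomial of `B`, and `n ∈ ℕ^r` with `|n| = deg P_B`.  If `h_{i,1},…,h_{i,nᵢ} ∈ [𝒫]_{eᵢ}`
concatenate to a filter-regular sequence on `B`, then for all `ν ≫ 0`,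
`n₁!⋯n_r!` times the coefficient of `X^n` in `P_B` equals
`dim_k [B/(h_{1,1},…,h_{r,n_r})B]_ν`. -/
theorem multigraded_van_der_Waerden
    {r : ℕ} (hr : 0 < r) (k : Type) [Field k] (dd : Fin r → ℕ)
    (J : Ideal (MvPolynomial ((i : Fin r) × Fin (dd i + 1)) k))
    (hJhom : ∀ p ∈ J, ∀ ν : Fin r → ℕ,
      MvPolynomial.weightedHomogeneousComponent (fun s => Pi.single s.1 1) ν p ∈ J)
    (hBnz : gammaTorsion
      ((irrelevantIdealOf (fun ν => MvPolynomial.weightedHomogeneousSubmodule k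
        (fun s : (i : Fin r) × Fin (dd i + 1) => Pi.single s.1 1) ν)))
      (MvPolynomial ((i : Fin r) × Fin (dd i + 1)) k ⧸ J) ≠ ⊤)
    (P : MvPolynomial (Fin r) ℚ)
    (hP : ∃ ν₀ : Fin r → ℕ, ∀ ν : Fin r → ℕ, (∀ i, ν₀ i ≤ ν i) →
      MvPolynomial.eval (fun i => (ν i : ℚ)) P =
        (Module.finrank k ↥((MvPolynomial.weightedHomogeneousSubmodule k
            (fun s : (i : Fin r) × Fin (dd i + 1) => Pi.single s.1 1) ν).map
          (Ideal.Quotient.mkₐ k J).toLinearMap) : ℚ))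
    (nn : Fin r → ℕ) (hnn : (∑ i, nn i) = P.totalDegree)
    (h : (i : Fin r) → Fin (nn i) → MvPolynomial ((i : Fin r) × Fin (dd i + 1)) k)
    (hhdeg : ∀ i j, h i j ∈ MvPolynomial.weightedHomogeneousSubmodule k
      (fun s : (i : Fin r) × Fin (dd i + 1) => Pi.single s.1 1) ((Pi.single i 1 : Fin r → ℕ)))
    (L : List (MvPolynomial ((i : Fin r) × Fin (dd i + 1)) k))
    (hL : L = (List.finRange r).flatMap fun i => List.ofFn (h i))
    (hreg : IsFilterRegularSeq
      (irrelevantIdealOf (fun ν => MvPolynomial.weightedHomogeneousSubmodule k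
        (fun s : (i : Fin r) × Fin (dd i + 1) => Pi.single s.1 1) ν))
      (MvPolynomial ((i : Fin r) × Fin (dd i + 1)) k ⧸ J) L) :
    ∃ ν₀ : Fin r → ℕ, ∀ ν : Fin r → ℕ, (∀ i, ν₀ i ≤ ν i) →
      (∏ i : Fin r, ((nn i).factorial : ℚ)) *
          MvPolynomial.coeff (Finsupp.equivFunOnFinite.symm nn) P =
        (Module.finrank k ↥((MvPolynomial.weightedHomogeneousSubmodule k
            (fun s : (i : Fin r) × Fin (dd i + 1) => Pi.single s.1 1) ν).map
          ((((listSMulSub L (MvPolynomial ((i : Fin r) × Fin (dd i + 1)) k ⧸ J)).mkQ).restrictScalars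
              k).comp (Ideal.Quotient.mkₐ k J).toLinearMap)) : ℚ) := by
  classical
  let l : List (Fin r × MvPolynomial ((i : Fin r) × Fin (dd i + 1)) k) :=
    (List.finRange r).flatMap fun i => List.ofFn fun j => (i, h i j)
  have hlL : l.map Prod.snd = L := by
    simp [l, hL, List.map_flatMap, List.map_ofFn, Function.comp_def]
  have hdeg : ∀ x ∈ l, x.2 ∈ MvPolynomial.weightedHomogeneousSubmodule k
      (multiWeight Sigma.fst) (Pi.single x.1 1) := by
    intro x hx
    obtain ⟨i, -, hi⟩ := List.mem_flatMap.mp hx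
    obtain ⟨j, rfl⟩ := List.mem_ofFn.mp hi
    exact hhdeg i j
  have hcount : ∀ i, nn i = (l.map Prod.fst).count i := by
    intro i
    simp only [l, List.map_flatMap, List.map_ofFn, Function.comp_def, List.ofFn_const,
      List.count_flatMap, List.count_replicate]
    simp [← Fin.sum_univ_def]
  have hfilter : ∀ l₁ x l₂, l = l₁ ++ x :: l₂ →
      ∃ N : ℕ, ∀ f ∈ irrelevantIdeal Sigma.fst k ^ N,
        x.2 * f ∈ J ⊔ Ideal.ofList (l₁.map Prod.snd) →
          f ∈ J ⊔ Ideal.ofList (l₁.map Prod.snd) := by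
    intro l₁ x l₂ hl
    have hL' : L = l₁.map Prod.snd ++ x.2 :: l₂.map Prod.snd := by rw [← hlL, hl]; simp
    have hx := hreg (l₁.map Prod.snd).length (by simp [hL'])
    subst hL'
    simp only [List.get_eq_getElem, List.getElem_append_right le_rfl,
      Nat.sub_self, List.getElem_cons_zero] at hx
    rw [isFilterRegular_quotient_listSMulSub_iff, List.take_left] at hx
    exact exists_pow_mem_of_mul_mem _ _ hx
  obtain ⟨ν₀, hν₀⟩ := hilbertFn_sup_ofList_eventually_eq (c := Sigma.fst) l hJhom hdeg hfilter hP
    (n := Finsupp.equivFunOnFinite.symm nn) hcount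
    (by rw [← hnn, Finsupp.degree_eq_sum]; simp)
  refine ⟨ν₀, fun ν hν => (hν₀ ν hν).trans (congrArg _ ?_)⟩
  have hfin := finite_weightedHomogeneousSubmodule (k := k)
    (c := (Sigma.fst : (i : Fin r) × Fin (dd i + 1) → Fin r)) ν
  rw [hlL]
  refine finrank_map_eq_of_ker_eq _ (SetLike.ext fun f => ?_)
  exact Ideal.Quotient.eq_zero_iff_mem.trans
    ((mk_mem_listSMulSub_iff J L f).symm.trans (Submodule.Quotient.mk_eq_zero _).symm)
end

section
/- High projective degrees are powers of δ: assume k is an infinite field and let c = ht(I). Then for every i with d−c+1 ≤ i ≤ d, the i-th projective degree of F : ℙ^d_k ⇢ ℙ^n_k satisfies d_i(F) = δ^{d−i}. -/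
section

variable {d : ℕ} (k : Type) [Field k]

/-- The bigraded Hilbert function of the Rees algebra of `I = (f₀,…,f_n)`:
`H(j,q) = dim_k [I^q]_{j+qδ}`. -/
noncomputable def reesHilbFn {n : ℕ} (δ : ℕ)
    (f : Fin (n + 1) → MvPolynomial (Fin (d + 1)) k) (j q : ℕ) : ℕ :=
  Module.finrank k
    ↥(((Ideal.span (Set.range f)) ^ q).restrictScalars k ⊓
      MvPolynomial.homogeneousSubmodule (Fin (d + 1)) k (j + q * δ))

/-- `P ∈ ℚ[u,v]` agrees with the bigraded function `H` for all `(j,q) ≫ (0,0)`. -/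
def IsBigradedHilbPoly (H : ℕ → ℕ → ℕ) (P : MvPolynomial (Fin 2) ℚ) : Prop :=
  ∃ j₀ q₀ : ℕ, ∀ j q : ℕ, j₀ ≤ j → q₀ ≤ q →
    MvPolynomial.eval ![(j : ℚ), (q : ℚ)] P = (H j q : ℚ)

/-- The `i`-th projective degree `d_i(F) = i!(d−i)!` times the coefficient of
`u^i v^{d-i}` in the bigraded Hilbert polynomial `P` of the Rees algebra. -/
noncomputable def projDeg (d : ℕ) (P : MvPolynomial (Fin 2) ℚ) (i : ℕ) : ℚ :=
  ((Nat.factorial i : ℚ) * (Nat.factorial (d - i) : ℚ)) *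
    MvPolynomial.coeff (Finsupp.single (0 : Fin 2) i + Finsupp.single (1 : Fin 2) (d - i)) P

/-- The height of an ideal: the infimum of the heights of the primes containing it. -/
noncomputable def idealHeight {R : Type} [CommRing R] (I : Ideal R) : ℕ∞ :=
  ⨅ (p : PrimeSpectrum R) (_ : I ≤ p.asIdeal), Order.height p

open MvPolynomial in
theorem finrank_restrictDegree_fin (k : Type*) [Field k] (s N : ℕ) :
    Module.finrank k (restrictDegree (Fin s) k N) = (N + 1) ^ s := by
  have e : {n : Fin s →₀ ℕ | ∀ i, n i ≤ N} ≃ (Fin s → Fin (N + 1)) :=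
    { toFun := fun n i => ⟨n.1 i, Nat.lt_succ_of_le (n.2 i)⟩
      invFun := fun g => ⟨Finsupp.equivFunOnFinite.symm fun i => (g i : ℕ),
        fun i => Nat.le_of_lt_succ (g i).2⟩
      left_inv := fun n => by ext; simp
      right_inv := fun g => by ext; simp }
  rw [restrictDegree, Module.finrank_eq_nat_card_basis (basisRestrictSupport k _),
    Nat.card_congr e]
  simp

open MvPolynomial in
theorem finrank_homogeneousSubmodule_fin (k : Type*) [Field k] (d m : ℕ) :
    Module.finrank k (homogeneousSubmodule (Fin (d + 1)) k m) = (m + d).choose d := by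
  have h : homogeneousSubmodule (Fin (d + 1)) k m = restrictSupport k {n | n.degree = m} :=
    homogeneousSubmodule_eq_finsupp_supported _ _ _
  have hs : {n : Fin (d + 1) →₀ ℕ | n.degree = m} =
      ((Finset.univ : Finset (Fin (d + 1))).finsuppAntidiag m : Set _) := by
    ext n
    simp [Finsupp.degree_eq_sum]
  rw [h, Module.finrank_eq_nat_card_basis (basisRestrictSupport k _), hs,
    Nat.card_coe_set_eq, Set.ncard_coe_finset, Finset.card_finsuppAntidiag_nat_eq_choose,
    Finset.card_univ, Fintype.card_fin, show d + 1 + m - 1 = m + d by omega]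
  exact Nat.choose_symm_add

open MvPolynomial in
/-- A finitely generated algebra that is finite over a polynomial ring in `s` variables grows
like a polynomial of degree at most `s`. -/
theorem exists_finrank_le_of_finite {k A : Type*} [Field k] [CommRing A] [Algebra k A] {s m : ℕ}
    (φ : MvPolynomial (Fin s) k →ₐ[k] A) (hφ : φ.Finite)
    (π : MvPolynomial (Fin m) k →ₐ[k] A) :
    ∃ C D : ℕ, ∀ N, ∃ V : Submodule k A, Module.Finite k V ∧
      Module.finrank k V ≤ C * (D * (N + 1) + 1) ^ s ∧
      ∀ p : MvPolynomial (Fin m) k, p.totalDegree ≤ N → π p ∈ V := by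
  algebraize [φ.toRingHom]
  have : IsScalarTower k (MvPolynomial (Fin s) k) A :=
    IsScalarTower.of_algebraMap_eq fun x => (φ.commutes x).symm
  have : Module.Finite (MvPolynomial (Fin s) k) A := hφ
  obtain ⟨r, F, hF⟩ := Module.Finite.exists_fin' (MvPolynomial (Fin s) k) A
  choose M hM using fun (i : Fin m) (l : Fin r) => hF (π (X i) * F (Pi.single l 1))
  obtain ⟨u, hu⟩ := hF 1
  let D : ℕ := (∑ i, ∑ l, ∑ j, (M i l j).totalDegree) + ∑ j, (u j).totalDegree
  have hDM : ∀ i l j, (M i l j).totalDegree ≤ D := fun i l j =>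
    ((((Finset.single_le_sum (f := fun j => (M i l j).totalDegree) (fun _ _ => zero_le)
      (Finset.mem_univ j)).trans
      (Finset.single_le_sum (f := fun l => ∑ j, (M i l j).totalDegree) (fun _ _ => zero_le)
      (Finset.mem_univ l))).trans
      (Finset.single_le_sum (f := fun i => ∑ l, ∑ j, (M i l j).totalDegree) (fun _ _ => zero_le)
      (Finset.mem_univ i)))).trans (Nat.le_add_right _ _)
  have hDu : ∀ j, (u j).totalDegree ≤ D := fun j =>
    (Finset.single_le_sum (f := fun j => (u j).totalDegree) (fun _ _ => zero_le)
      (Finset.mem_univ j)).trans (Nat.le_add_left _ _)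
  let G (N : ℕ) : (Fin r → restrictDegree (Fin s) k N) →ₗ[k] A :=
    (F.restrictScalars k) ∘ₗ (restrictDegree (Fin s) k N).subtype.compLeft (Fin r)
  -- the elements of `A` with coordinates of total degree at most `N`
  let S (N : ℕ) : Set A := {a | ∃ c : Fin r → MvPolynomial (Fin s) k,
    (∀ j, (c j).totalDegree ≤ N) ∧ F c = a}
  have hSG : ∀ N, S N ⊆ LinearMap.range (G N) := by
    rintro N _ ⟨c, hc, rfl⟩
    exact ⟨fun j => ⟨c j, restrictTotalDegree_le_restrictDegree _ _ _
      ((mem_restrictTotalDegree _ _ _).2 (hc j))⟩, rfl⟩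
  have hmul : ∀ N a i, a ∈ S N → π (X i) * a ∈ S (N + D) := by
    rintro N _ i ⟨c, hc, rfl⟩
    refine ⟨∑ l, c l • M i l, fun j => ?_, ?_⟩
    · rw [Finset.sum_apply]
      refine totalDegree_finsetSum_le fun l _ => ?_
      exact (totalDegree_mul _ _).trans (add_le_add (hc l) (hDM i l j))
    · conv_rhs => rw [pi_eq_sum_univ' c]
      simp only [map_sum, map_smul, hM, Finset.mul_sum, mul_smul_comm]
  have hmon : ∀ t, ∀ e : Fin m →₀ ℕ, e.degree = t → π (monomial e 1) ∈ S (D * (t + 1)) := by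
    intro t
    induction t with
    | zero =>
      intro e he
      rw [Finsupp.degree_eq_zero_iff] at he
      subst he
      refine ⟨u, by simpa using hDu, ?_⟩
      rw [hu, show (monomial (0 : Fin m →₀ ℕ) (1 : k)) = 1 from rfl, map_one]
    | succ t ih =>
      intro e he
      obtain ⟨i, hi⟩ : ∃ i, e i ≠ 0 := by
        by_contra! h
        have : e = 0 := Finsupp.ext h
        simp [this] at he
      have hle : Finsupp.single i 1 ≤ e := by
        simpa using Nat.one_le_iff_ne_zero.2 hi
      have hsplit : e = Finsupp.single i 1 + (e - Finsupp.single i 1) :=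
        (add_tsub_cancel_of_le hle).symm
      have hdeg : (e - Finsupp.single i 1).degree = t := by
        have := congrArg Finsupp.degree hsplit
        rw [map_add, Finsupp.degree_single] at this
        omega
      have := hmul _ _ i (ih _ hdeg)
      rw [← map_mul, X, monomial_mul, one_mul, ← hsplit] at this
      rwa [mul_add_one D (t + 1)]
  refine ⟨r, D, fun N => ⟨LinearMap.range (G (D * (N + 1))), inferInstance, ?_, fun p hp => ?_⟩⟩
  · refine (LinearMap.finrank_range_le _).trans ?_
    rw [Module.finrank_pi_fintype, Finset.sum_const, finrank_restrictDegree_fin]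
    simp
  · rw [p.as_sum, map_sum]
    refine Submodule.sum_mem _ fun e he => ?_
    rw [show monomial e (coeff e p) = coeff e p • monomial e 1 by simp [smul_monomial], map_smul]
    refine Submodule.smul_mem _ _ (hSG _ ?_)
    obtain ⟨c, hc, h⟩ := hmon _ e rfl
    have hN : e.degree ≤ N := (le_totalDegree he).trans hp
    exact ⟨c, fun j => (hc j).trans (by gcongr), h⟩

/-- If every prime over `J` has height at least `c` and `A ⧸ J` is an integral extension of a
polynomial ring in `s` variables, then `s + c` is at most the dimension of `A`. -/
theorem add_le_of_injective_of_isIntegral {k : Type*} [Field k] {A : Type*} [CommRing A]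
    {J : Ideal A} {s c e : ℕ} (hA : ringKrullDim A ≤ e)
    (hc : ∀ p : PrimeSpectrum A, J ≤ p.asIdeal → (c : ℕ∞) ≤ Order.height p)
    (φ : MvPolynomial (Fin s) k →+* A ⧸ J) (hinj : Function.Injective φ) (hint : φ.IsIntegral) :
    s + c ≤ e := by
  algebraize [φ]
  have hdim : (s : WithBot ℕ∞) ≤ Order.krullDim (PrimeSpectrum (MvPolynomial (Fin s) k)) := by
    change _ ≤ ringKrullDim _
    rw [MvPolynomial.ringKrullDim_of_isNoetherianRing, ringKrullDim_eq_zero_of_field]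
    simp
  obtain ⟨l, hl⟩ := Order.le_krullDim_iff.1 hdim
  have : FaithfulSMul (MvPolynomial (Fin s) k) (A ⧸ J) :=
    (faithfulSMul_iff_algebraMap_injective _ _).2 hinj
  obtain ⟨P, hP⟩ := Ideal.nonempty_primesOver (S := A ⧸ J) l.head.asIdeal
  have := hP.1
  have := hP.2
  obtain ⟨L, hL, -, -⟩ := Ideal.exists_ltSeries_of_hasGoingUp l P
  have hmono : StrictMono (PrimeSpectrum.comap (Ideal.Quotient.mk J)) := by
    have h : Function.Injective (PrimeSpectrum.comap (Ideal.Quotient.mk J)) :=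
      PrimeSpectrum.comap_injective_of_surjective _ Ideal.Quotient.mk_surjective
    refine Monotone.strictMono_of_injective (fun a b hab => ?_) h
    exact Ideal.comap_mono hab
  let L' := L.map _ hmono
  have h1 : (s : ℕ∞) ≤ Order.coheight L'.head := by
    have := Order.length_le_coheight_head (p := L')
    simpa [L', hL, hl] using this
  have h2 : (c : ℕ∞) ≤ Order.height L'.head := by
    refine hc _ fun x hx => ?_
    change Ideal.Quotient.mk J x ∈ L.head.asIdeal
    rw [Ideal.Quotient.eq_zero_iff_mem.2 hx]
    exact zero_mem _
  have hne : Nonempty (PrimeSpectrum A) := ⟨L'.head⟩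
  rw [ringKrullDim, Order.krullDim_eq_iSup_height_add_coheight_of_nonempty] at hA
  have h3 := (le_iSup (fun a : PrimeSpectrum A => Order.height a + Order.coheight a) L'.head).trans
    (WithBot.coe_le_coe.1 hA)
  have h4 : ((s + c : ℕ) : ℕ∞) ≤ (e : ℕ) := by
    rw [Nat.cast_add, add_comm]
    exact (add_le_add h2 h1).trans h3
  exact_mod_cast h4

open MvPolynomial in
/-- For a homogeneous ideal `J`, the partial sums of the Hilbert function of the quotient by `J`
are bounded by the dimension of any subspace containing the classes of all polynomials of
bounded total degree. -/
theorem sum_finrank_sub_le {k : Type*} [Field k] {m : ℕ} {J : Ideal (MvPolynomial (Fin m) k)}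
    (hJ : ∀ p ∈ J, ∀ t, homogeneousComponent t p ∈ J) {N : ℕ}
    (V : Submodule k (MvPolynomial (Fin m) k ⧸ J)) [Module.Finite k V]
    (hV : ∀ p : MvPolynomial (Fin m) k, p.totalDegree ≤ N → Ideal.Quotient.mkₐ k J p ∈ V) :
    ∑ t ∈ Finset.range (N + 1), (Module.finrank k (homogeneousSubmodule (Fin m) k t) -
      Module.finrank k ↥(J.restrictScalars k ⊓ homogeneousSubmodule (Fin m) k t)) ≤
      Module.finrank k V := by
  have hfin : ∀ t, Module.Finite k (homogeneousSubmodule (Fin m) k t) := fun t =>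
    Module.Finite.iff_fg.2 (homogeneousSubmodule_fg _ _ t)
  choose W hW using fun t => Submodule.exists_isCompl
    ((J.restrictScalars k).comap (homogeneousSubmodule (Fin m) k t).subtype)
  have hrank : ∀ t, Module.finrank k (homogeneousSubmodule (Fin m) k t) -
      Module.finrank k ↥(J.restrictScalars k ⊓ homogeneousSubmodule (Fin m) k t) =
      Module.finrank k (W t) := by
    intro t
    have h := Submodule.finrank_add_eq_of_isCompl (hW t)
    rw [← Submodule.finrank_map_subtype_eq, Submodule.map_comap_subtype, inf_comm] at h
    omega
  simp only [hrank]
  let Λ : ((t : Fin (N + 1)) → W t) →ₗ[k] MvPolynomial (Fin m) k :=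
    ∑ t : Fin (N + 1), (homogeneousSubmodule (Fin m) k t).subtype ∘ₗ (W t).subtype ∘ₗ
      LinearMap.proj t
  have hΛ : ∀ w, Λ w = ∑ t : Fin (N + 1), ((w t : homogeneousSubmodule (Fin m) k t) : MvPolynomial (Fin m) k) := by
    intro w
    simp [Λ]
  have hmem : ∀ w, (Ideal.Quotient.mkₐ k J).toLinearMap (Λ w) ∈ V := by
    refine fun w => hV _ ?_
    rw [hΛ]
    refine totalDegree_finsetSum_le fun t _ => ?_
    exact (IsHomogeneous.totalDegree_le (w t).1.2).trans (Nat.le_of_lt_succ t.2)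
  let Θ : ((t : Fin (N + 1)) → W t) →ₗ[k] V :=
    ((Ideal.Quotient.mkₐ k J).toLinearMap ∘ₗ Λ).codRestrict V hmem
  have hinj : Function.Injective Θ := by
    rw [← LinearMap.ker_eq_bot, LinearMap.ker_eq_bot']
    intro w hw
    have hmem : Λ w ∈ J := Ideal.Quotient.eq_zero_iff_mem.1 (congrArg Subtype.val hw)
    funext t
    have ht := hJ _ hmem t
    have hcomp : homogeneousComponent (t : ℕ) (Λ w) = (w t).1 := by
      rw [hΛ, map_sum, Finset.sum_eq_single t]
      · rw [homogeneousComponent_of_mem (w t).1.2, if_pos rfl]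
      · intro b _ hb
        rw [homogeneousComponent_of_mem (w b).1.2, if_neg]
        exact fun h => hb (Fin.ext h.symm)
      · simp
    rw [hcomp] at ht
    have h0 := (Submodule.disjoint_def.1 (hW t).disjoint) (w t).1 ht (w t).2
    exact Subtype.ext h0
  have := LinearMap.finrank_le_finrank_of_injective hinj
  rwa [Module.finrank_pi_fintype, Fin.sum_univ_eq_sum_range (fun t => Module.finrank k (W t))]
    at this

open Filter Polynomial Topology in
/-- A polynomial whose values at large naturals are nonnegative and whose partial sums grow
at most like `N ^ s` has degree less than `s`. -/
theorem coeff_eq_zero_of_sum_le (g : ℚ[X]) {s j₀ C a b : ℕ}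
    (hpos : ∀ j : ℕ, j₀ ≤ j → 0 ≤ g.eval (j : ℚ))
    (hsum : ∀ N : ℕ, ∑ j ∈ Finset.Ico j₀ N, g.eval (j : ℚ) ≤ C * (a * N + b : ℚ) ^ s) {i : ℕ}
    (hi : s ≤ i) : g.coeff i = 0 := by
  by_contra hne
  have hdeg : s ≤ g.natDegree := hi.trans (le_natDegree_of_ne_zero hne)
  have hg : g ≠ 0 := fun h => hne (by simp [h])
  have hlim : Tendsto (fun j : ℕ => g.eval (j : ℚ) / (j : ℚ) ^ g.natDegree) atTop
      (𝓝 g.leadingCoeff) := by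
    have h := div_tendsto_atTop_leadingCoeff_div_of_degree_eq g (X ^ g.natDegree)
      (by rw [degree_X_pow, degree_eq_natDegree hg])
    simpa [Function.comp_def] using h.comp tendsto_natCast_atTop_atTop
  have hlc : 0 < g.leadingCoeff := by
    refine lt_of_le_of_ne (ge_of_tendsto hlim ?_) (leadingCoeff_ne_zero.2 hg).symm
    filter_upwards [eventually_ge_atTop j₀] with j hj
    exact div_nonneg (hpos j hj) (by positivity)
  obtain ⟨ε, hε, hεlt⟩ := exists_between hlc
  obtain ⟨J, hJ⟩ := eventually_atTop.1 (hlim.eventually (lt_mem_nhds hεlt))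
  obtain ⟨M, hM⟩ := exists_nat_gt (C * (2 * a + b : ℚ) ^ s / ε)
  set N := max (max J j₀) (max M 1) with hN
  have hNJ : J ≤ N := by omega
  have hNj : j₀ ≤ N := by omega
  have hNM : M ≤ N := by omega
  have hN1 : 1 ≤ N := by omega
  have hNpos : (0 : ℚ) < N := by exact_mod_cast hN1
  have hlow : ∀ j ∈ Finset.Ico N (2 * N), ε * (N : ℚ) ^ s ≤ g.eval (j : ℚ) := by
    intro j hj
    obtain ⟨hj, -⟩ := Finset.mem_Ico.1 hj
    have hj1 : (1 : ℚ) ≤ j := by exact_mod_cast hN1.trans hj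
    have h := (lt_div_iff₀ (by positivity)).1 (hJ j (hNJ.trans hj))
    refine le_trans ?_ h.le
    have h1 : (N : ℚ) ^ s ≤ (j : ℚ) ^ s := by gcongr
    have h2 : (j : ℚ) ^ s ≤ (j : ℚ) ^ g.natDegree := pow_le_pow_right₀ hj1 hdeg
    exact mul_le_mul_of_nonneg_left (h1.trans h2) hε.le
  have h1 : (N : ℚ) * (ε * (N : ℚ) ^ s) ≤ ∑ j ∈ Finset.Ico N (2 * N), g.eval (j : ℚ) := by
    have := Finset.card_nsmul_le_sum _ _ _ hlow
    rwa [Nat.card_Ico, show 2 * N - N = N by omega, nsmul_eq_mul] at this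
  have h2 : ∑ j ∈ Finset.Ico N (2 * N), g.eval (j : ℚ) ≤
      ∑ j ∈ Finset.Ico j₀ (2 * N), g.eval (j : ℚ) :=
    Finset.sum_le_sum_of_subset_of_nonneg (Finset.Ico_subset_Ico_left hNj)
      fun j hj _ => hpos j (Finset.mem_Ico.1 hj).1
  have h3 : (C : ℚ) * (a * (2 * N : ℕ) + b : ℚ) ^ s ≤ C * ((2 * a + b) * N) ^ s := by
    have : (b : ℚ) ≤ b * N := le_mul_of_one_le_right (by positivity) (by exact_mod_cast hN1)
    gcongr
    push_cast
    linarith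
  have h4 := ((h1.trans h2).trans (hsum _)).trans h3
  rw [mul_pow, ← mul_assoc, ← mul_assoc] at h4
  have h5 := le_of_mul_le_mul_right h4 (by positivity)
  have h6 := (div_lt_iff₀ hε).1 hM
  have h7 : (M : ℚ) * ε ≤ N * ε := by gcongr
  linarith

open MvPolynomial in
/-- If the coefficient of `uⁱ` in `G(u, q)` vanishes for all large naturals `q`, then every
coefficient of `uⁱ vˡ` in `G(u, v)` vanishes. -/
theorem coeff_eq_zero_of_forall_coeff_map_eq_zero (G : MvPolynomial (Fin 2) ℚ) {i q₀ : ℕ}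
    (h : ∀ q : ℕ, q₀ ≤ q →
      ((finSuccEquiv ℚ 1 G).map (eval ![(q : ℚ)])).coeff i = 0) (l : ℕ) :
    coeff (Finsupp.single 0 i + Finsupp.single 1 l) G = 0 := by
  have hz : (finSuccEquiv ℚ 1 G).coeff i = 0 := by
    have hinf : ((fun q : ℕ => (q : ℚ)) '' Set.Ici q₀).Infinite :=
      (Set.Ici_infinite q₀).image Nat.cast_injective.injOn
    refine MvPolynomial.funext_set (fun _ => (fun q : ℕ => (q : ℚ)) '' Set.Ici q₀) (fun _ => hinf) fun x hx => ?_
    obtain ⟨q, hq, hxq⟩ := hx 0 (Set.mem_univ _)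
    have hx : x = ![(q : ℚ)] := by
      ext j
      rw [Subsingleton.elim j 0, ← hxq]
      simp
    simpa [hx] using h q hq
  have hcons : Finsupp.single 0 i + Finsupp.single 1 l =
      (Finsupp.single (0 : Fin 1) l).cons i := by
    ext j
    refine Fin.cases ?_ (fun j => ?_) j
    · simp
    · rw [Finsupp.cons_succ, Subsingleton.elim j 0]
      simp
  rw [hcons, ← finSuccEquiv_coeff_coeff, hz, coeff_zero]

open MvPolynomial in
theorem coeff_aeval_preHilbertPoly (d δ i : ℕ) (hi : i ≤ d) :
    coeff (Finsupp.single 0 i + Finsupp.single 1 (d - i))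
      (Polynomial.aeval (X 0 + C (δ : ℚ) * X 1 : MvPolynomial (Fin 2) ℚ)
        (Polynomial.preHilbertPoly ℚ d 0)) = (δ : ℚ) ^ (d - i) / (i.factorial * (d - i).factorial) := by
  set L : MvPolynomial (Fin 2) ℚ := X 0 + C (δ : ℚ) * X 1
  have hL : L.IsHomogeneous 1 := (isHomogeneous_X _ _).add (isHomogeneous_C_mul_X _ _)
  set e : Fin 2 →₀ ℕ := Finsupp.single 0 i + Finsupp.single 1 (d - i) with he
  have hdeg : e.degree = d := by rw [he, map_add, Finsupp.degree_single, Finsupp.degree_single]; omega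
  have hLd : coeff e (L ^ d) = d.choose i * (δ : ℚ) ^ (d - i) := by
    have hterm : ∀ j, (X 0 : MvPolynomial (Fin 2) ℚ) ^ j * (C (δ : ℚ) * X 1) ^ (d - j) *
        (d.choose j : MvPolynomial (Fin 2) ℚ) =
        monomial (Finsupp.single 0 j + Finsupp.single 1 (d - j))
          (d.choose j * (δ : ℚ) ^ (d - j)) := by
      intro j
      rw [← map_natCast (C : ℚ →+* MvPolynomial (Fin 2) ℚ), mul_pow, ← C_pow, mul_left_comm,
        mul_assoc, mul_comm _ (C _), ← mul_assoc, ← C_mul, X_pow_eq_monomial, X_pow_eq_monomial,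
        monomial_mul, C_mul_monomial, mul_comm (_ ^ _)]
      simp
    rw [add_pow, coeff_sum, Finset.sum_eq_single i]
    · rw [hterm, coeff_monomial, if_pos rfl]
    · intro j _ hj
      rw [hterm, coeff_monomial, if_neg]
      intro h
      apply hj
      simpa [he] using DFunLike.congr_fun h 0
    · intro h
      simp at h
      omega
  rw [Polynomial.aeval_eq_sum_range, Polynomial.natDegree_preHilbertPoly, coeff_sum,
    Finset.sum_eq_single d]
  · rw [coeff_smul, Polynomial.coeff_preHilbertPoly_self, hLd, Nat.cast_choose ℚ hi, smul_eq_mul]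
    field_simp
  · intro j _ hj
    rw [coeff_smul, (hL.pow j).coeff_eq_zero (by omega), smul_zero]
  · simp

/-- **High projective degrees are powers of `δ`** (Proposition 5.5(ii)).
If `k` is infinite and `c = ht I`, then `d_i(F) = δ^{d-i}` for all `d − c + 1 ≤ i ≤ d`. -/
theorem projDeg_high_eq_pow_delta
    [Infinite k]
    {n : ℕ} (hdn : d ≤ n) (δ : ℕ) (hδ : 0 < δ)
    (f : Fin (n + 1) → MvPolynomial (Fin (d + 1)) k)
    (hf : ∀ j, f j ≠ 0 ∧ (f j).IsHomogeneous δ)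
    (P : MvPolynomial (Fin 2) ℚ)
    (hP : IsBigradedHilbPoly (reesHilbFn k δ f) P)
    (hPdeg : P.totalDegree = d)
    (c : ℕ) (hc : idealHeight (Ideal.span (Set.range f)) = (c : ℕ∞)) :
    ∀ i : ℕ, d + 1 ≤ i + c → i ≤ d → projDeg d P i = (δ : ℚ) ^ (d - i) := by
  intro i hi hid
  let _ := MvPolynomial.gradedAlgebra (σ := Fin (d + 1)) (R := k)
  set I : Ideal (MvPolynomial (Fin (d + 1)) k) := Ideal.span (Set.range f)
  have hhom : ∀ q, (I ^ q).IsHomogeneous (MvPolynomial.homogeneousSubmodule (Fin (d + 1)) k) := by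
    have hI : I.IsHomogeneous (MvPolynomial.homogeneousSubmodule (Fin (d + 1)) k) := by
      refine Ideal.homogeneous_span _ _ ?_
      rintro _ ⟨j, rfl⟩
      exact ⟨δ, (hf j).2⟩
    intro q
    induction q with
    | zero => simpa using Ideal.IsHomogeneous.top _
    | succ q ih => exact pow_succ I q ▸ ih.mul hI
  have hht : ∀ q, ∀ p : PrimeSpectrum (MvPolynomial (Fin (d + 1)) k), I ^ q ≤ p.asIdeal →
      (c : ℕ∞) ≤ Order.height p := by
    intro q p hp
    rw [← hc]
    exact iInf₂_le p (Ideal.IsPrime.le_of_pow_le hp)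
  have hItop : I ≠ ⊤ := by
    intro h
    have : idealHeight I = ⊤ := by
      simp only [idealHeight, iInf_eq_top]
      intro p hp
      exact absurd (top_le_iff.1 (h ▸ hp)) p.isPrime.ne_top
    rw [this] at hc
    exact ENat.natCast_ne_top c hc.symm
  obtain ⟨j₀, q₀, hP⟩ := hP
  let B : MvPolynomial (Fin 2) ℚ :=
    Polynomial.aeval (MvPolynomial.X 0 + MvPolynomial.C (δ : ℚ) * MvPolynomial.X 1)
      (Polynomial.preHilbertPoly ℚ d 0)
  have hfinR : ∀ t, Module.Finite k (MvPolynomial.homogeneousSubmodule (Fin (d + 1)) k t) :=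
    fun t => Module.Finite.iff_fg.2 (MvPolynomial.homogeneousSubmodule_fg _ _ t)
  have hB : ∀ j q : ℕ, MvPolynomial.eval ![(j : ℚ), (q : ℚ)] B =
      Module.finrank k (MvPolynomial.homogeneousSubmodule (Fin (d + 1)) k (j + q * δ)) := by
    intro j q
    have h : MvPolynomial.eval ![(j : ℚ), (q : ℚ)] B =
        (Polynomial.preHilbertPoly ℚ d 0).eval ((j + q * δ : ℕ) : ℚ) := by
      rw [← MvPolynomial.coe_aeval_eq_eval, RingHom.coe_coe, ← Polynomial.aeval_algHom_apply]
      simp [mul_comm, Polynomial.aeval_def, Polynomial.eval₂_eq_eval_map]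
    rw [h, Polynomial.preHilbertPoly_eq_choose_sub_add ℚ d (Nat.zero_le _),
      finrank_homogeneousSubmodule_fin, Nat.sub_zero]
  have hGeval : ∀ j q : ℕ, j₀ ≤ j → q₀ ≤ q → MvPolynomial.eval ![(j : ℚ), (q : ℚ)] (B - P) =
      ((Module.finrank k (MvPolynomial.homogeneousSubmodule (Fin (d + 1)) k (j + q * δ)) -
        reesHilbFn k δ f j q : ℕ) : ℚ) := by
    intro j q hj hq
    have hle : reesHilbFn k δ f j q ≤ Module.finrank k
        (MvPolynomial.homogeneousSubmodule (Fin (d + 1)) k (j + q * δ)) :=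
      Submodule.finrank_mono inf_le_right
    rw [map_sub, hB, hP j q hj hq, Nat.cast_sub hle]
  have hcoeff : MvPolynomial.coeff (Finsupp.single 0 i + Finsupp.single 1 (d - i)) (B - P) = 0 := by
    refine coeff_eq_zero_of_forall_coeff_map_eq_zero (B - P) (q₀ := max q₀ 1) (fun q hq => ?_) _
    have hq₀ : q₀ ≤ q := (le_max_left _ _).trans hq
    have hq1 : q ≠ 0 := by omega
    have hne : I ^ q ≠ ⊤ := fun h => hItop (top_le_iff.1 (h ▸ Ideal.pow_le_self hq1))
    have := Ideal.Quotient.nontrivial_iff.2 hne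
    obtain ⟨s, φ, hinj, hfin⟩ :=
      exists_finite_inj_algHom_of_fg k (MvPolynomial (Fin (d + 1)) k ⧸ I ^ q)
    have hsc : s + c ≤ d + 1 := by
      refine add_le_of_injective_of_isIntegral ?_ (hht q) φ.toRingHom hinj hfin.to_isIntegral
      rw [MvPolynomial.ringKrullDim_of_isNoetherianRing, ringKrullDim_eq_zero_of_field]
      simp
    obtain ⟨a, b, hab⟩ := exists_finrank_le_of_finite φ hfin (Ideal.Quotient.mkₐ k (I ^ q))
    have hev : ∀ j : ℕ, ((MvPolynomial.finSuccEquiv ℚ 1 (B - P)).map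
        (MvPolynomial.eval ![(q : ℚ)])).eval (j : ℚ) =
        MvPolynomial.eval ![(j : ℚ), (q : ℚ)] (B - P) := fun j =>
      (MvPolynomial.eval_eq_eval_mv_eval' _ _ _).symm
    refine coeff_eq_zero_of_sum_le _ (s := s) (j₀ := j₀) (C := a) (a := b)
      (b := b * (q * δ + 1) + 1) (fun j hj => ?_) (fun N => ?_) (by omega)
    · rw [hev, hGeval j q hj hq₀]
      positivity
    · obtain ⟨V, hV, hVle, hVmem⟩ := hab (N + q * δ)
      have h := (sum_finrank_sub_le
        (fun p hp t => MvPolynomial.homogeneousComponent_mem_of_mem (hhom q) hp t) V hVmem).trans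
        hVle
      calc _ = ((∑ j ∈ Finset.Ico j₀ N, (Module.finrank k
            (MvPolynomial.homogeneousSubmodule (Fin (d + 1)) k (j + q * δ)) -
            reesHilbFn k δ f j q) : ℕ) : ℚ) := by
            rw [Nat.cast_sum]
            exact Finset.sum_congr rfl fun j hj => by
              rw [hev, hGeval j q (Finset.mem_Ico.1 hj).1 hq₀]
        _ ≤ ((a * (b * (N + q * δ + 1) + 1) ^ s : ℕ) : ℚ) := by
            refine Nat.cast_le.2 (le_trans ?_ h)
            refine le_trans (le_of_eq ?_) (Finset.sum_le_sum_of_subset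
              (s := (Finset.Ico j₀ N).map (addRightEmbedding (q * δ))) ?_)
            · rw [Finset.sum_map]
              rfl
            · intro t ht
              simp only [Finset.mem_map, Finset.mem_Ico, addRightEmbedding_apply] at ht
              obtain ⟨j, hj, rfl⟩ := ht
              exact Finset.mem_range.2 (by omega)
        _ = _ := by
            push_cast
            ring
  rw [MvPolynomial.coeff_sub, sub_eq_zero] at hcoeff
  rw [projDeg, ← hcoeff, coeff_aeval_preHilbertPoly d δ i hid]
  field_simp


end
end
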